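/- arXiv:1310.1439 — 2 statements merged into one kernel-verified Lean document; each statement's English description precedes it below -/
import Mathlib

section
/- Assume C11·C11† = I_p, C11·C21ᵀ = 0, C21·C11† = 0, C21·C21ᵀ = I_{m−p}, and C11†·C11 + C21ᵀ·C21 = I_m. Fix s0 ∈ F and set M' = s0·I_{n−m} − A22 + A21·C11†·C12. If there exists a nonzero vector w0 ∈ F^{n−m} with w0ᵀ·M' = 0 and w0ᵀ·A21·C21ᵀ = 0, then the (n−m+p)×n block matrix N = [[−A21, M'],[C11, 0]] has rank < n−m+p; indeed the nonzero row vector [w0ᵀ, w0ᵀ·A21·C11†] satisfies [w0ᵀ, w0ᵀ·A21·C11†]·N = 0. -/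
open Matrix

/-- A matrix with a nonzero left null vector does not have full row rank. -/
theorem Matrix.rank_lt_card_of_vecMul_eq_zero {K m n : Type*} [Field K] [Fintype m] [Fintype n]
    {M : Matrix m n K} {v : m → K} (hv : v ≠ 0) (h : v ᵥ* M = 0) :
    M.rank < Fintype.card m := by
  refine lt_of_le_of_ne M.rank_le_card_height fun hrank => hv ?_
  have hli : LinearIndependent K M.row := by
    rw [linearIndependent_iff_card_eq_finrank_span, ← hrank]
    exact M.rank_eq_finrank_span_row
  exact Matrix.vecMul_injective_iff.2 hli (by simpa using h)

/-- Over a field `F`, with `m = p + q` (index type `Fin p ⊕ Fin q`)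
and `n − m = r`, assume the five orthogonality relations.  Set
`M' = s₀·I_{n−m} − A22 + A21·C11†·C12`.  If a nonzero `w0` satisfies `w0ᵀ·M' = 0` and
`w0ᵀ·A21·C21ᵀ = 0`, then `N = [[−A21, M'],[C11, 0]]` has rank `< (n−m) + p`; indeed
the nonzero row vector `[w0ᵀ, w0ᵀ·A21·C11†]` annihilates `N` on the left. -/
theorem squaring_up_stmt7 (F : Type*) [Field F] (p q r : ℕ)
    (hp : 0 < p) (hq : 0 < q) (hr : 0 < r)
    (A21 : Matrix (Fin r) (Fin p ⊕ Fin q) F)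
    (A22 : Matrix (Fin r) (Fin r) F)
    (C11 : Matrix (Fin p) (Fin p ⊕ Fin q) F)
    (C12 : Matrix (Fin p) (Fin r) F)
    (C11d : Matrix (Fin p ⊕ Fin q) (Fin p) F)
    (C21 : Matrix (Fin q) (Fin p ⊕ Fin q) F)
    (h1 : C11 * C11d = 1) (h2 : C11 * C21ᵀ = 0)
    (h3 : C21 * C11d = 0) (h4 : C21 * C21ᵀ = 1)
    (h5 : C11d * C11 + C21ᵀ * C21 = 1)
    (s₀ : F) (w0 : Fin r → F) (hw0 : w0 ≠ 0)
    (hM : Matrix.vecMul w0 (s₀ • 1 - A22 + A21 * C11d * C12) = 0)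
    (hB : Matrix.vecMul (Matrix.vecMul w0 A21) C21ᵀ = 0) :
    (fromBlocks (-A21) (s₀ • 1 - A22 + A21 * C11d * C12) C11 0).rank < r + p ∧
    Sum.elim w0 (Matrix.vecMul (Matrix.vecMul w0 A21) C11d) ≠ 0 ∧
    Matrix.vecMul (Sum.elim w0 (Matrix.vecMul (Matrix.vecMul w0 A21) C11d))
        (fromBlocks (-A21) (s₀ • 1 - A22 + A21 * C11d * C12) C11 0) = 0 := by
  have hne : Sum.elim w0 (Matrix.vecMul (Matrix.vecMul w0 A21) C11d) ≠ 0 := fun h =>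
    hw0 (funext fun i => congrFun h (Sum.inl i))
  have hA : (w0 ᵥ* A21 ᵥ* C11d) ᵥ* C11 = w0 ᵥ* A21 := by
    have h := congrArg (fun X => (w0 ᵥ* A21) ᵥ* X) h5
    simpa only [vecMul_add, ← vecMul_vecMul, hB, zero_vecMul, add_zero, vecMul_one] using h
  have hnull : Matrix.vecMul (Sum.elim w0 (Matrix.vecMul (Matrix.vecMul w0 A21) C11d))
      (fromBlocks (-A21) (s₀ • 1 - A22 + A21 * C11d * C12) C11 0) = 0 := by
    rw [vecMul_fromBlocks]
    simp only [Sum.elim_comp_inl, Sum.elim_comp_inr, hM, hA, vecMul_neg, vecMul_zero,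
      neg_add_cancel, add_zero, Sum.elim_zero_zero]
  refine ⟨?_, hne, hnull⟩
  simpa using Matrix.rank_lt_card_of_vecMul_eq_zero hne hnull
end

section
/- Let C11·C11† = I_p, C11·C21ᵀ = 0, C21·C11† = 0, C21·C21ᵀ = I_{m−p} hold, so that C1 = [[C11],[C21]] is invertible with inverse [C11†, C21ᵀ]. Then for every C22 ∈ F^{(m−p)×(n−m)}, with C2 = [[C12],[C22]], one has the identity A22 − A21·C1⁻¹·C2 = Ã22 − B_ps2·C22, where Ã22 = A22 − A21·C11†·C12 and B_ps2 = A21·C21ᵀ. In particular, choosing the design matrix C22 is equivalent to applying the state feedback gain C22 to the pair (Ã22, B_ps2). -/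
open Matrix

/-- A square matrix split into two blocks of rows is inverted by the two blocks of columns that
are dual to them. -/
theorem Matrix.inv_fromRows_eq_fromCols {R m₁ m₂ : Type*} [CommRing R]
    [Fintype m₁] [Fintype m₂] [DecidableEq m₁] [DecidableEq m₂]
    {A₁ : Matrix m₁ (m₁ ⊕ m₂) R} {A₂ : Matrix m₂ (m₁ ⊕ m₂) R}
    {B₁ : Matrix (m₁ ⊕ m₂) m₁ R} {B₂ : Matrix (m₁ ⊕ m₂) m₂ R}
    (h₁₁ : A₁ * B₁ = 1) (h₁₂ : A₁ * B₂ = 0) (h₂₁ : A₂ * B₁ = 0) (h₂₂ : A₂ * B₂ = 1) :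
    (fromRows A₁ A₂)⁻¹ = fromCols B₁ B₂ := by
  apply inv_eq_right_inv
  rw [fromRows_mul_fromCols, h₁₁, h₁₂, h₂₁, h₂₂, fromBlocks_one]

/-- Over a field `F`, with `m = p + q` (index type `Fin p ⊕ Fin q`)
and `n − m = r`, assume `C11·C11† = I_p`, `C11·C21ᵀ = 0`, `C21·C11† = 0`,
`C21·C21ᵀ = I_{m−p}`, so that `C1 = [[C11],[C21]]` is invertible with inverse
`[C11†, C21ᵀ]`.  Then for every `C22`, with `C2 = [[C12],[C22]]`,
`A22 − A21·C1⁻¹·C2 = Ã22 − B_ps2·C22` where `Ã22 = A22 − A21·C11†·C12` and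
`B_ps2 = A21·C21ᵀ`. -/
theorem squaring_up_stmt13 (F : Type*) [Field F] (p q r : ℕ)
    (hp : 0 < p) (hq : 0 < q) (hr : 0 < r)
    (A21 : Matrix (Fin r) (Fin p ⊕ Fin q) F)
    (A22 : Matrix (Fin r) (Fin r) F)
    (C11 : Matrix (Fin p) (Fin p ⊕ Fin q) F)
    (C12 : Matrix (Fin p) (Fin r) F)
    (C11d : Matrix (Fin p ⊕ Fin q) (Fin p) F)
    (C21 : Matrix (Fin q) (Fin p ⊕ Fin q) F)
    (h1 : C11 * C11d = 1) (h2 : C11 * C21ᵀ = 0)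
    (h3 : C21 * C11d = 0) (h4 : C21 * C21ᵀ = 1) :
    ∀ C22 : Matrix (Fin q) (Fin r) F,
      A22 - A21 * (fromRows C11 C21)⁻¹ * fromRows C12 C22
        = (A22 - A21 * C11d * C12) - (A21 * C21ᵀ) * C22 := by
  intro C22
  rw [inv_fromRows_eq_fromCols h1 h2 h3 h4, Matrix.mul_assoc, fromCols_mul_fromRows,
    Matrix.mul_add, ← Matrix.mul_assoc, ← Matrix.mul_assoc, sub_sub]
end
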